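/- arXiv:2002.04667 — 4 statements merged into one kernel-verified Lean document; each statement's English description precedes it below -/
import Mathlib

section
/- Let ℓ be a positive integer and let p be a prime number. Let K be a number field having the subfield property such that p is inert in K. Then there exists a finite field extension L of K with [L : K] = ℓ such that p is inert in L and L has the subfield property. -/
open NumberField

/-- A number field `K` has the *subfield property* if for every divisor `d` of the
degree `[K : ℚ]` there exists a subfield of `K` of absolute degree `d` over `ℚ`. -/
def HasSubfieldProperty (K : Type*) [Field K] [NumberField K] : Prop :=
  ∀ d : ℕ, d ∣ Module.finrank ℚ K → ∃ F : IntermediateField ℚ K, Module.finrank ℚ F = d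

/-- A prime number `p` is *inert* in a number field `K` if the ideal generated by `p`
in the ring of integers of `K` is maximal. -/
def IsInertIn (p : ℕ) (K : Type*) [Field K] [NumberField K] : Prop :=
  (Ideal.span {(p : 𝓞 K)}).IsMaximal

open Polynomial Module

theorem irreducible_map_of_coprime_finrank {E κ : Type*} [Field E] [Field κ] [Algebra E κ]
    [FiniteDimensional E κ] {g : E[X]} (hg : Irreducible g)
    (h : g.natDegree.Coprime (finrank E κ)) : Irreducible (g.map (algebraMap E κ)) := by
  have hg0 : g.map (algebraMap E κ) ≠ 0 := Polynomial.map_ne_zero hg.ne_zero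
  obtain ⟨f, hf, hfg⟩ := WfDvdMonoid.exists_irreducible_factor
    (Polynomial.not_isUnit_of_natDegree_pos (g.map (algebraMap E κ))
      (by rw [natDegree_map]; exact hg.natDegree_pos)) hg0
  have : Fact (Irreducible f) := ⟨hf⟩
  have : FiniteDimensional κ (AdjoinRoot f) := (AdjoinRoot.powerBasis hf.ne_zero).finite
  have : FiniteDimensional E (AdjoinRoot f) := FiniteDimensional.trans E κ (AdjoinRoot f)
  have hroot : aeval (AdjoinRoot.root f) g = 0 := by
    rw [← aeval_map_algebraMap κ]
    obtain ⟨r, hr⟩ := hfg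
    rw [hr, map_mul, AdjoinRoot.aeval_eq, AdjoinRoot.mk_self, zero_mul]
  have hdeg : (minpoly E (AdjoinRoot.root f)).natDegree = g.natDegree := by
    rw [← minpoly.eq_of_irreducible hg hroot,
      natDegree_mul_C (inv_ne_zero (leadingCoeff_ne_zero.2 hg.ne_zero))]
  have hdvd : g.natDegree ∣ f.natDegree := by
    have h1 := minpoly.degree_dvd (K := E) (IsIntegral.of_finite E (AdjoinRoot.root f))
    rw [hdeg, ← finrank_mul_finrank E κ (AdjoinRoot f),
      (AdjoinRoot.powerBasis hf.ne_zero).finrank, AdjoinRoot.powerBasis_dim] at h1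
    exact h.dvd_of_dvd_mul_left h1
  have hassoc : Associated f (g.map (algebraMap E κ)) :=
    associated_of_dvd_of_natDegree_le hfg hg0
      (by rw [natDegree_map]; exact Nat.le_of_dvd hf.natDegree_pos hdvd)
  exact hassoc.irreducible hf

theorem FiniteField.exists_monic_irreducible_natDegree_eq (E : Type*) [Field E] [Finite E]
    {n : ℕ} (hn : 0 < n) : ∃ g : E[X], g.Monic ∧ Irreducible g ∧ g.natDegree = n := by
  obtain ⟨p, _⟩ := CharP.exists E
  have : Fact p.Prime := ⟨CharP.char_is_prime E p⟩
  have : NeZero n := ⟨hn.ne'⟩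
  obtain ⟨α, hα⟩ := Field.exists_primitive_element E (FiniteField.Extension E p n)
  have hint := IsIntegral.of_finite E α
  refine ⟨minpoly E α, minpoly.monic hint, minpoly.irreducible hint, ?_⟩
  rw [(Field.primitive_element_iff_minpoly_natDegree_eq E α).1 hα,
    FiniteField.finrank_extension]

theorem absNorm_span_natCast_eq (p : ℕ) (K : Type*) [Field K] [NumberField K] :
    (Ideal.span {(p : 𝓞 K)}).absNorm = p ^ finrank ℚ K := by
  rw [Ideal.absNorm_span_natCast, RingOfIntegers.rank]

theorem isInertIn_of_irreducible_of_root {p : ℕ} (hp : p.Prime) {K L : Type*} [Field K]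
    [NumberField K] [Field L] [NumberField L] [Algebra K L] (hpK : IsInertIn p K)
    {g : (𝓞 K)[X]} (hdeg : (g.map (Ideal.Quotient.mk (Ideal.span {(p : 𝓞 K)}))).natDegree =
      finrank K L)
    (hirr : Irreducible (g.map (Ideal.Quotient.mk (Ideal.span {(p : 𝓞 K)}))))
    {x : 𝓞 L} (hx : aeval x g = 0) : IsInertIn p L := by
  have hpK' : (Ideal.span {(p : 𝓞 K)}).IsMaximal := hpK
  have hne : Ideal.span {(p : 𝓞 L)} ≠ ⊤ := by
    rw [Ne, ← Ideal.absNorm_eq_one_iff, absNorm_span_natCast_eq]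
    exact (Nat.one_lt_pow finrank_pos.ne' hp.one_lt).ne'
  obtain ⟨P, hP, hle⟩ := Ideal.exists_le_maximal _ hne
  have hunder : Ideal.span {(p : 𝓞 K)} = P.under (𝓞 K) := by
    refine hpK'.eq_of_le (Ideal.IsPrime.under _ P).ne_top ?_
    rw [Ideal.span_singleton_le_iff_mem, Ideal.under, Ideal.mem_comap, map_natCast]
    exact hle (Ideal.mem_span_singleton_self _)
  have : P.LiesOver (Ideal.span {(p : 𝓞 K)}) := ⟨hunder⟩
  let _ : Field (𝓞 K ⧸ Ideal.span {(p : 𝓞 K)}) := Ideal.Quotient.field _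
  let _ : Field (𝓞 L ⧸ P) := Ideal.Quotient.field P
  have hP0 : P ≠ ⊥ := by
    rintro rfl
    rw [le_bot_iff, Ideal.span_singleton_eq_bot] at hle
    exact hp.ne_zero (by exact_mod_cast hle)
  have hcard : P.absNorm =
      (p ^ finrank ℚ K) ^ finrank (𝓞 K ⧸ Ideal.span {(p : 𝓞 K)}) (𝓞 L ⧸ P) := by
    rw [← absNorm_span_natCast_eq p K, Ideal.absNorm_apply, Ideal.absNorm_apply,
      Submodule.cardQuot_apply, Submodule.cardQuot_apply]
    exact Module.natCard_eq_pow_finrank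
  have hroot : aeval (Ideal.Quotient.mk P x)
      (g.map (Ideal.Quotient.mk (Ideal.span {(p : 𝓞 K)}))) = 0 := by
    rw [← Ideal.Quotient.algebraMap_eq P, ← Ideal.Quotient.algebraMap_eq (Ideal.span {(p : 𝓞 K)}),
      aeval_map_algebraMap, aeval_algebraMap_apply, hx, map_zero]
  have hdvd : finrank K L ∣ finrank (𝓞 K ⧸ Ideal.span {(p : 𝓞 K)}) (𝓞 L ⧸ P) := by
    have h1 := minpoly.degree_dvd (IsIntegral.of_finite (𝓞 K ⧸ Ideal.span {(p : 𝓞 K)})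
      (Ideal.Quotient.mk P x))
    rwa [← minpoly.eq_of_irreducible hirr hroot,
      natDegree_mul_C (inv_ne_zero (leadingCoeff_ne_zero.2 hirr.ne_zero)), hdeg] at h1
  have heq : Ideal.span {(p : 𝓞 L)} = P := by
    obtain ⟨J, hJ⟩ := Ideal.dvd_iff_le.2 hle
    have h1 : P.absNorm * J.absNorm = p ^ finrank ℚ L := by
      rw [← map_mul, ← hJ, absNorm_span_natCast_eq]
    have h2 : p ^ finrank ℚ L ∣ P.absNorm := by
      rw [hcard, ← pow_mul, ← finrank_mul_finrank ℚ K L]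
      exact pow_dvd_pow _ (Nat.mul_le_mul_left _ (Nat.le_of_dvd finrank_pos hdvd))
    have h3 : J.absNorm = 1 := by
      rw [← h1] at h2
      exact Nat.dvd_one.1 ((mul_dvd_mul_iff_left (a := P.absNorm)
        (Ideal.absNorm_eq_zero_iff.not.2 hP0)).1 (by rwa [mul_one]))
    rw [hJ, Ideal.absNorm_eq_one_iff.1 h3, Ideal.mul_top]
  rwa [IsInertIn, heq]

theorem under_span_natCast (p : ℕ) (F K : Type*) [Field F] [NumberField F] [Field K]
    [NumberField K] [Algebra F K] :
    (Ideal.span {(p : 𝓞 K)}).under (𝓞 F) = Ideal.span {(p : 𝓞 F)} := by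
  have := Ideal.comap_map_eq_self_of_faithfullyFlat (B := 𝓞 K) (Ideal.span {(p : 𝓞 F)})
  rwa [Ideal.map_span, Set.image_singleton, map_natCast] at this

theorem exists_monic_irreducible_map_of_isInertIn {p : ℕ} (hp : p.Prime) {K : Type*} [Field K]
    [NumberField K] (hpK : IsInertIn p K) (F : IntermediateField ℚ K) {q : ℕ} (hq : 0 < q)
    (hcop : q.Coprime (finrank F K)) :
    ∃ g : (𝓞 F)[X], g.Monic ∧ g.natDegree = q ∧
      Irreducible ((g.map (algebraMap (𝓞 F) (𝓞 K))).map
        (Ideal.Quotient.mk (Ideal.span {(p : 𝓞 K)}))) := by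
  have hpK' : (Ideal.span {(p : 𝓞 K)}).IsMaximal := hpK
  have : (Ideal.span {(p : 𝓞 K)}).LiesOver (Ideal.span {(p : 𝓞 F)}) :=
    ⟨(under_span_natCast p F K).symm⟩
  have hpF : (Ideal.span {(p : 𝓞 F)}).IsMaximal := by
    rw [← under_span_natCast p F K]
    exact Ideal.isMaximal_comap_of_isIntegral_of_isMaximal _
  let _ : Field (𝓞 K ⧸ Ideal.span {(p : 𝓞 K)}) := Ideal.Quotient.field _
  let _ : Field (𝓞 F ⧸ Ideal.span {(p : 𝓞 F)}) := Ideal.Quotient.field _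
  have hcardF : Nat.card (𝓞 F ⧸ Ideal.span {(p : 𝓞 F)}) = p ^ finrank ℚ F := by
    rw [← absNorm_span_natCast_eq p F, Ideal.absNorm_apply, Submodule.cardQuot_apply]
  have hcardK : Nat.card (𝓞 K ⧸ Ideal.span {(p : 𝓞 K)}) = p ^ finrank ℚ K := by
    rw [← absNorm_span_natCast_eq p K, Ideal.absNorm_apply, Submodule.cardQuot_apply]
  have : Finite (𝓞 F ⧸ Ideal.span {(p : 𝓞 F)}) :=
    Nat.finite_of_card_ne_zero (hcardF ▸ pow_ne_zero _ hp.ne_zero)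
  have hrank : finrank (𝓞 F ⧸ Ideal.span {(p : 𝓞 F)}) (𝓞 K ⧸ Ideal.span {(p : 𝓞 K)}) =
      finrank F K := by
    have h1 := Module.natCard_eq_pow_finrank (K := 𝓞 F ⧸ Ideal.span {(p : 𝓞 F)})
      (V := 𝓞 K ⧸ Ideal.span {(p : 𝓞 K)})
    rw [hcardF, hcardK, ← pow_mul, ← finrank_mul_finrank ℚ F K] at h1
    exact (Nat.eq_of_mul_eq_mul_left finrank_pos (Nat.pow_right_injective hp.two_le h1)).symm
  obtain ⟨h, hmon, hirr, hdeg⟩ := FiniteField.exists_monic_irreducible_natDegree_eq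
    (𝓞 F ⧸ Ideal.span {(p : 𝓞 F)}) hq
  obtain ⟨g, hgh, hgdeg, hgmon⟩ := lifts_and_natDegree_eq_and_monic
    ((mem_lifts h).2 (map_surjective _ Ideal.Quotient.mk_surjective h)) hmon
  refine ⟨g, hgmon, hgdeg.trans hdeg, ?_⟩
  have := irreducible_map_of_coprime_finrank hirr
    (κ := 𝓞 K ⧸ Ideal.span {(p : 𝓞 K)}) (by rwa [hdeg, hrank])
  rw [← hgh, Polynomial.map_map] at this
  rwa [Polynomial.map_map]

theorem exists_extension_root {K : Type} [Field K] [NumberField K] {f : K[X]}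
    (hf : Irreducible f) : ∃ (L : Type) (_ : Field L) (_ : NumberField L) (_ : Algebra K L),
      finrank K L = f.natDegree ∧ ∃ x : L, aeval x f = 0 := by
  have : Fact (Irreducible f) := ⟨hf⟩
  have : Module.Finite K (AdjoinRoot f) := (AdjoinRoot.powerBasis hf.ne_zero).finite
  refine ⟨AdjoinRoot f, inferInstance, NumberField.of_module_finite K _, inferInstance, ?_,
    AdjoinRoot.root f, ?_⟩
  · rw [(AdjoinRoot.powerBasis hf.ne_zero).finrank, AdjoinRoot.powerBasis_dim]
  · rw [AdjoinRoot.aeval_eq, AdjoinRoot.mk_self]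

theorem exists_intermediateField_finrank_eq_of_tower {K L : Type*} [Field K] [NumberField K]
    [Field L] [NumberField L] [Algebra K L] (F : IntermediateField ℚ K) :
    ∃ M : IntermediateField ℚ L, finrank ℚ M = finrank ℚ F :=
  ⟨F.map (IsScalarTower.toAlgHom ℚ K L),
    (F.equivMap (IsScalarTower.toAlgHom ℚ K L)).toLinearEquiv.finrank_eq.symm⟩

theorem exists_intermediateField_finrank_eq_mul {L : Type*} [Field L] [NumberField L]
    (A B : IntermediateField ℚ L) (h : (finrank ℚ A).Coprime (finrank ℚ B)) :
    ∃ M : IntermediateField ℚ L, finrank ℚ M = finrank ℚ A * finrank ℚ B :=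
  ⟨A ⊔ B, (IntermediateField.LinearDisjoint.of_finrank_coprime h).finrank_sup⟩

theorem exists_prime_extension_subfield_property {q : ℕ} (hq : q.Prime) {p : ℕ} (hp : p.Prime)
    {K : Type} [Field K] [NumberField K] (hK : HasSubfieldProperty K) (hpK : IsInertIn p K) :
    ∃ (L : Type) (_ : Field L) (_ : NumberField L) (_ : Algebra K L),
      finrank K L = q ∧ IsInertIn p L ∧ HasSubfieldProperty L := by
  obtain ⟨a, k, hqk, hk⟩ := Nat.exists_eq_pow_mul_and_not_dvd
    (finrank_pos (R := ℚ) (M := K)).ne' q hq.ne_one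
  obtain ⟨F, hF⟩ := hK (q ^ a) (hk ▸ dvd_mul_right _ _)
  have hFK : finrank F K = k := by
    rw [← finrank_mul_finrank ℚ F K, hF] at hk
    exact Nat.eq_of_mul_eq_mul_left (pow_pos hq.pos a) hk
  obtain ⟨g, hgmon, hgdeg, hgirr⟩ := exists_monic_irreducible_map_of_isInertIn hp hpK F hq.pos
    (by rw [hFK]; exact hq.coprime_iff_not_dvd.2 hqk)
  have hpK' : (Ideal.span {(p : 𝓞 K)}).IsMaximal := hpK
  set G := g.map (algebraMap (𝓞 F) (𝓞 K)) with hG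
  have hGmon : G.Monic := hgmon.map _
  have hGirr : Irreducible (G.map (algebraMap (𝓞 K) K)) :=
    hGmon.irreducible_iff_irreducible_map_fraction_map.1
      (hGmon.irreducible_of_irreducible_map (Ideal.Quotient.mk _) G hgirr)
  obtain ⟨L, _, _, _, hKL, x, hx⟩ := exists_extension_root hGirr
  have hGdeg : G.natDegree = q := by rw [hgmon.natDegree_map, hgdeg]
  rw [hGmon.natDegree_map, hGdeg] at hKL
  rw [aeval_map_algebraMap] at hx
  obtain ⟨y, rfl⟩ := (IsIntegralClosure.isIntegral_iff (A := 𝓞 L)).1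
    (isIntegral_trans (R := ℤ) (A := 𝓞 K) x ⟨G, hGmon, hx⟩)
  rw [aeval_algebraMap_apply, FaithfulSMul.algebraMap_eq_zero_iff] at hx
  refine ⟨L, inferInstance, inferInstance, inferInstance, hKL, ?_, ?_⟩
  · exact isInertIn_of_irreducible_of_root hp hpK (by rw [hGmon.natDegree_map, hGdeg, hKL])
      hgirr hx
  have hirrF : Irreducible (g.map (algebraMap (𝓞 F) F)) := by
    refine (hgmon.map _).irreducible_of_irreducible_map (algebraMap F K) _ ?_
    rw [hG, Polynomial.map_map] at hGirr
    rw [Polynomial.map_map]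
    exact hGirr
  have hxF : aeval (y : L) (g.map (algebraMap (𝓞 F) F)) = 0 := by
    have : IsScalarTower (𝓞 F) (𝓞 K) (𝓞 L) := IsScalarTower.of_algebraMap_eq fun _ => rfl
    rw [aeval_map_algebraMap, aeval_algebraMap_apply, ← aeval_map_algebraMap (𝓞 K), hx, map_zero]
  have hMrank : finrank ℚ ((IntermediateField.adjoin F {(y : L)}).restrictScalars ℚ) =
      q ^ (a + 1) := by
    change finrank ℚ (IntermediateField.adjoin F {(y : L)}) = _
    rw [← finrank_mul_finrank ℚ F, hF,
      IntermediateField.adjoin.finrank (IsIntegral.of_finite F (y : L)),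
      ← minpoly.eq_of_irreducible_of_monic hirrF hxF (hgmon.map _), hgmon.natDegree_map, hgdeg,
      pow_succ]
  intro d hd
  rw [← finrank_mul_finrank ℚ K L, hKL, hk] at hd
  obtain ⟨b, m, hqm, rfl⟩ := Nat.exists_eq_pow_mul_and_not_dvd
    (ne_zero_of_dvd_ne_zero (mul_ne_zero (hk ▸ finrank_pos.ne') hq.ne_zero) hd) q hq.ne_one
  have hmk : m ∣ k := by
    have hcop := hq.coprime_iff_not_dvd.2 hqm
    exact (hcop.symm.pow_right a).dvd_of_dvd_mul_left
      (hcop.symm.dvd_of_dvd_mul_right ((dvd_mul_left _ _).trans hd))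
  by_cases hb : b ≤ a
  · obtain ⟨N, hN⟩ := hK (q ^ b * m) (hk ▸ mul_dvd_mul (pow_dvd_pow q hb) hmk)
    rw [← hN]
    exact exists_intermediateField_finrank_eq_of_tower N
  have hb' : b = a + 1 := by
    have h1 : q ^ b ∣ q ^ (a + 1) * k := by
      rw [pow_succ, mul_right_comm]
      exact (dvd_mul_right _ _).trans hd
    have h2 := ((hq.coprime_iff_not_dvd.2 hqk).pow_left b).dvd_of_dvd_mul_right h1
    have h3 := (Nat.pow_dvd_pow_iff_le_right hq.one_lt).1 h2
    omega
  obtain ⟨N, hN⟩ := hK m (hk ▸ hmk.mul_left _)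
  obtain ⟨N', hN'⟩ := exists_intermediateField_finrank_eq_of_tower (L := L) N
  rw [hb', ← hMrank, ← hN, ← hN']
  refine exists_intermediateField_finrank_eq_mul _ _ ?_
  rw [hMrank, hN', hN]
  exact (hq.coprime_iff_not_dvd.2 hqm).pow_left _

/-- **Proposition on suitable extensions.** Let ℓ be a positive integer and
let p be a prime number. Let K be a number field having the subfield property such that p
is inert in K. Then there exists a finite field extension L of K with [L : K] = ℓ such
that p is inert in L and L has the subfield property. -/
theorem exists_extension_subfield_property (ℓ : ℕ) (hℓ : 0 < ℓ) (p : ℕ) (hp : p.Prime)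
    (K : Type) [Field K] [NumberField K]
    (hK : HasSubfieldProperty K) (hpK : IsInertIn p K) :
    ∃ (L : Type) (_ : Field L) (_ : NumberField L) (_ : Algebra K L),
      Module.finrank K L = ℓ ∧ IsInertIn p L ∧ HasSubfieldProperty L := by
  induction ℓ using induction_on_primes with
  | zero => exact absurd hℓ (lt_irrefl 0)
  | one => exact ⟨K, inferInstance, inferInstance, inferInstance, finrank_self K, hpK, hK⟩
  | prime_mul q n hq ih =>
    obtain ⟨M, _, _, _, hKM, hpM, hM⟩ := ih (Nat.pos_of_mul_pos_left hℓ)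
    obtain ⟨L, _, _, _, hML, hpL, hL⟩ := exists_prime_extension_subfield_property hq hp hM hpM
    let _ : Algebra K L := ((algebraMap M L).comp (algebraMap K M)).toAlgebra
    have : IsScalarTower K M L := IsScalarTower.of_algebraMap_eq fun _ => rfl
    refine ⟨L, inferInstance, inferInstance, inferInstance, ?_, hpL, hL⟩
    rw [← finrank_mul_finrank K M L, hKM, hML, mul_comm]
end

section
/- Let R be a commutative ring, let J be an ideal of R, and let I be a prime ideal of R containing J. Define two sequences of ideals of R as follows: I_1 = I and I_n = I_{n-1}·I + J for n ≥ 2; and I_1' = I, and for n ≥ 2, I_n' = (I_{n-1}'·I + J) + ⟨T_n⟩, where T_n ⊆ R is any set of elements such that for every x ∈ T_n the ideal quotient ((I_{n-1}'·I + J) : (x)) is not contained in I. Then for every positive integer n the ideals I_n·R_I and I_n'·R_I of the localization R_I are equal. -/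
/-- Adjoining elements whose quotient ideals are not contained in a prime `I` does not change the
extension of an ideal to the localization at `I`. -/
theorem Ideal.map_atPrime_sup_span_eq {R : Type*} [CommRing R] (I : Ideal R) [I.IsPrime]
    (K : Ideal R) (T : Set R)
    (hT : ∀ x ∈ T, ¬ Submodule.colon K (Ideal.span {x}) ≤ I) :
    Ideal.map (algebraMap R (Localization.AtPrime I)) (K ⊔ Ideal.span T) =
      Ideal.map (algebraMap R (Localization.AtPrime I)) K := by
  rw [Ideal.map_sup, sup_eq_left, Ideal.map_le_iff_le_comap, Ideal.span_le]
  intro x hx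
  obtain ⟨r, hr, hrI⟩ := SetLike.not_le_iff_exists.mp (hT x hx)
  rw [Ideal.mem_colon_span_singleton] at hr
  have hu : IsUnit (algebraMap R (Localization.AtPrime I) r) :=
    IsLocalization.map_units (Localization.AtPrime I) (⟨r, hrI⟩ : I.primeCompl)
  rw [SetLike.mem_coe, Ideal.mem_comap, ← Ideal.unit_mul_mem_iff_mem _ hu, ← map_mul]
  exact Ideal.mem_map_of_mem _ hr

/-- Let R be a commutative ring, let J be an ideal of R, and let I be a
prime ideal of R containing J. Define two sequences of ideals of R as follows:
I_1 = I and I_n = I_{n-1}·I + J for n ≥ 2; and I_1' = I, and for n ≥ 2,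
I_n' = (I_{n-1}'·I + J) + ⟨T_n⟩, where T_n ⊆ R is any set of elements such that for every
x ∈ T_n the ideal quotient ((I_{n-1}'·I + J) : (x)) is not contained in I. Then for every
positive integer n the ideals I_n·R_I and I_n'·R_I of the localization R_I are equal. -/
theorem localization_map_modified_ideals_eq {R : Type*} [CommRing R] (J I : Ideal R)
    [I.IsPrime] (hJI : J ≤ I) (A A' : ℕ → Ideal R) (T : ℕ → Set R)
    (hA1 : A 1 = I)
    (hA : ∀ n, 2 ≤ n → A n = A (n - 1) * I ⊔ J)
    (hA'1 : A' 1 = I)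
    (hT : ∀ n, 2 ≤ n → ∀ x ∈ T n,
      ¬ Submodule.colon (A' (n - 1) * I ⊔ J) (Ideal.span {x}) ≤ I)
    (hA' : ∀ n, 2 ≤ n → A' n = (A' (n - 1) * I ⊔ J) ⊔ Ideal.span (T n)) :
    ∀ n, 1 ≤ n →
      Ideal.map (algebraMap R (Localization.AtPrime I)) (A n) =
        Ideal.map (algebraMap R (Localization.AtPrime I)) (A' n) := by
  intro n hn
  induction n, hn using Nat.le_induction with
  | base => rw [hA1, hA'1]
  | succ n hn ih =>
    have h2 : 2 ≤ n + 1 := Nat.succ_le_succ hn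
    rw [hA' _ h2, Ideal.map_atPrime_sup_span_eq I _ _ (hT _ h2), hA _ h2, Nat.add_sub_cancel,
      Ideal.map_sup, Ideal.map_sup, Ideal.map_mul, Ideal.map_mul, ih]
end

section
/- Let R be a commutative ring, let J be an ideal of R, and let I be a prime ideal of R containing J. Let m ≥ 1 and let q ∈ R be an element whose image under the localization map R → R_I lies in (I^m + J)·R_I (i.e., q vanishes with order at least m on the component defined by I). Let r and n be natural numbers with n ≤ r, set e = ⌊r/m⌋ + 1, and let f, g ∈ R. Then the image of f in R_I lies in (I^n + J)·R_I if and only if the image of f + q^e·g in R_I lies in (I^n + J)·R_I. -/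
/-- Modulo `J`, powers of `A ⊔ J` agree with powers of `A`. -/
theorem Ideal.sup_pow_le_pow_sup {S : Type*} [CommSemiring S] (A J : Ideal S) (k : ℕ) :
    (A ⊔ J) ^ k ≤ A ^ k ⊔ J := by
  induction k with
  | zero => simp
  | succ k ih =>
    calc (A ⊔ J) ^ (k + 1) ≤ (A ^ k ⊔ J) * (A ⊔ J) := by
          rw [pow_succ]
          exact Ideal.mul_mono_left ih
      _ ≤ A ^ (k + 1) ⊔ J := by
          rw [Ideal.sup_mul, Ideal.mul_sup (A ^ k), ← pow_succ]
          exact sup_le (sup_le_sup_left Ideal.mul_le_right _)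
            (Ideal.mul_le_left.trans le_sup_right)

/-- Let R be a commutative ring, let J be an ideal of R, and let I be a
prime ideal of R containing J. Let m ≥ 1 and let q ∈ R be an element whose image under
the localization map R → R_I lies in (I^m + J)·R_I. Let r and n be natural numbers with
n ≤ r, set e = ⌊r/m⌋ + 1, and let f, g ∈ R. Then the image of f in R_I lies in
(I^n + J)·R_I if and only if the image of f + q^e·g in R_I lies in (I^n + J)·R_I. -/
theorem mem_localization_iff_add_pow_mul_mem {R : Type*} [CommRing R] (J I : Ideal R)
    [I.IsPrime] (hJI : J ≤ I) (m : ℕ) (hm : 1 ≤ m) (q : R)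
    (hq : algebraMap R (Localization.AtPrime I) q ∈
      Ideal.map (algebraMap R (Localization.AtPrime I)) (I ^ m ⊔ J))
    (r n : ℕ) (hn : n ≤ r) (f g : R) :
    algebraMap R (Localization.AtPrime I) f ∈
      Ideal.map (algebraMap R (Localization.AtPrime I)) (I ^ n ⊔ J) ↔
    algebraMap R (Localization.AtPrime I) (f + q ^ (r / m + 1) * g) ∈
      Ideal.map (algebraMap R (Localization.AtPrime I)) (I ^ n ⊔ J) := by
  have hle : n ≤ m * (r / m + 1) := hn.trans (Nat.lt_mul_div_succ r hm).le
  have hpow : (I ^ m ⊔ J) ^ (r / m + 1) ≤ I ^ n ⊔ J :=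
    (Ideal.sup_pow_le_pow_sup _ _ _).trans
      (sup_le_sup_right (by rw [← pow_mul]; exact Ideal.pow_le_pow_right hle) J)
  have hmem : algebraMap R (Localization.AtPrime I) (q ^ (r / m + 1) * g) ∈
      Ideal.map (algebraMap R (Localization.AtPrime I)) (I ^ n ⊔ J) := by
    rw [map_mul, map_pow]
    refine Ideal.mul_mem_right _ _ (Ideal.map_mono hpow ?_)
    rw [Ideal.map_pow]
    exact Ideal.pow_mem_pow hq _
  rw [map_add, Ideal.add_mem_iff_left _ hmem]
end

section
/- Let F be a field and let N be a 2×3 matrix over F of rank 2. Let M be the 2×2 matrix formed by the last two columns of N (so that the columns of M are the second and third columns of N). Then the 2×3 matrix adj(M)·N is nonzero, where adj(M) denotes the adjugate matrix of M. In particular, if det(M) = 0, then the first column of adj(M)·N is not the zero vector. -/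
/-- A matrix over a field whose rank equals its number of rows has injective `vecMul`. -/
theorem Matrix.vecMul_injective_of_rank_eq_card {F m n : Type*} [Field F] [Fintype m] [Fintype n]
    (N : Matrix m n F) (hN : N.rank = Fintype.card m) :
    Function.Injective N.vecMul := by
  rw [Matrix.vecMul_injective_iff, linearIndependent_iff_card_eq_finrank_span, ← hN,
    Matrix.rank_eq_finrank_span_row]
  rfl


/-- Let F be a field and let N be a 2×3 matrix over F of rank 2. Let M be
the 2×2 matrix formed by the last two columns of N. Then the 2×3 matrix adj(M)·N is
nonzero; in particular, if det(M) = 0, then the first column of adj(M)·N is not the zero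
vector. -/
theorem adjugate_mul_ne_zero_of_rank_two {F : Type*} [Field F]
    (N : Matrix (Fin 2) (Fin 3) F) (hN : N.rank = 2)
    (M : Matrix (Fin 2) (Fin 2) F) (hM : M = N.submatrix id Fin.succ) :
    M.adjugate * N ≠ 0 ∧
      (M.det = 0 → (fun i : Fin 2 => (M.adjugate * N) i 0) ≠ 0) := by
  have inj : ∀ v : Fin 2 → F, Matrix.vecMul v N = 0 → v = 0 := fun v hv =>
    N.vecMul_injective_of_rank_eq_card (by simpa using hN) (hv.trans (Matrix.zero_vecMul N).symm)
  have key : M.adjugate * N ≠ 0 := by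
    intro h
    have hadj : M.adjugate = 0 := by
      ext i j
      have hi : Matrix.vecMul (M.adjugate i) N = 0 := by
        rw [← Matrix.mul_apply_eq_vecMul, h]
        rfl
      exact congrFun (inj _ hi) j
    have hM0 : M = 0 := by
      simpa [hadj] using (Matrix.adjugate_adjugate' M).symm
    have hN0 : ∀ (i : Fin 2) (j : Fin 2), N i j.succ = 0 := fun i j =>
      congrFun (congrFun (hM.symm.trans hM0) i) j
    have hv : ![N 1 0, -N 0 0] = 0 := by
      apply inj
      ext j
      refine Fin.cases ?_ (fun j => ?_) j
      · simp [Matrix.vecMul, dotProduct, Fin.sum_univ_two]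
        ring
      · simp [Matrix.vecMul, dotProduct, hN0]
    have h10 : N 1 0 = 0 := congrFun hv 0
    have h00 : N 0 0 = 0 := neg_eq_zero.mp (congrFun hv 1)
    have hzero : N = 0 := by
      ext i j
      refine Fin.cases ?_ (fun j => hN0 i j) j
      fin_cases i
      · exact h00
      · exact h10
    simp [hzero] at hN
  refine ⟨key, fun hdet hcol => key ?_⟩
  ext i j
  refine Fin.cases (congrFun hcol i) (fun j => ?_) j
  have hmul : M.adjugate * M = 0 := by rw [Matrix.adjugate_mul, hdet, zero_smul]
  calc (M.adjugate * N) i j.succ = (M.adjugate * M) i j := by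
        rw [Matrix.mul_apply, Matrix.mul_apply, hM]
        rfl
    _ = 0 := by rw [hmul]; rfl
end
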